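/- Let T > 0 and n ≥ 1. Suppose f_i(t,x,u) ∈ C¹([0,T]×ℝⁿ×ℝ) with continuous mixed derivatives ∂²f_i/∂x_j∂u and ∂²f_i/∂t∂u, and g(t,x,u) is continuous and right-Lipschitz in u on every compact set. Let u and v be Kruzkov entropy solutions on [0,T]×ℝⁿ with |u| ≤ M and |v| ≤ M almost everywhere. Then for every nonnegative test function φ ∈ C_c^∞((0,T)×ℝⁿ) and every constant L such that (g(t,x,w) − g(t,x,z))/(w − z) ≤ L for all (t,x) in the support of φ and all w ≠ z ∈ [−M,M], one has ∬_{[0,T]×ℝⁿ} sgn(u(t,x) − v(t,x)) { (u(t,x) − v(t,x)) φ_t + Σ_{i=1}^n (f_i(t,x,u(t,x)) − f_i(t,x,v(t,x))) φ_{x_i} + L (u(t,x) − v(t,x)) φ } dt dx ≥ 0. -/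

import Mathlib

open MeasureTheory Set Filter

noncomputable section

/-- Euclidean space `ℝⁿ`. -/
abbrev Euc (n : ℕ) := EuclideanSpace ℝ (Fin n)

/-- A Kruzkov entropy solution of `u_t + ∑ ∂_{x_i} f_i(t,x,u) = g(t,x,u)` on `[0,T] × ℝⁿ`
with initial data `u₀`. -/
def IsEntropySol (n : ℕ) (T : ℝ)
    (f : Fin n → ℝ × Euc n × ℝ → ℝ)
    (g : ℝ × Euc n × ℝ → ℝ)
    (u : ℝ × Euc n → ℝ) (u₀ : Euc n → ℝ) : Prop :=
  Measurable u ∧ (∃ C : ℝ, ∀ p, |u p| ≤ C) ∧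
  (∀ k : ℝ, ∀ φ : ℝ × Euc n → ℝ,
    ContDiff ℝ (⊤ : ℕ∞) φ → HasCompactSupport φ → (∀ p, 0 ≤ φ p) →
    (∀ p : ℝ × Euc n, p.1 ∉ Set.Ioo 0 T → φ p = 0) →
    0 ≤ ∫ p in (Set.Ioo (0:ℝ) T) ×ˢ (Set.univ : Set (Euc n)),
        (|u p - k| * fderiv ℝ φ p (1, 0)
          + ∑ i, Real.sign (u p - k) * (f i (p.1, p.2, u p) - f i (p.1, p.2, k))
              * fderiv ℝ φ p (0, EuclideanSpace.single i 1)
          + Real.sign (u p - k)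
              * (-(∑ i, fderiv ℝ (f i) (p.1, p.2, k) (0, EuclideanSpace.single i 1, 0))
                  + g (p.1, p.2, u p)) * φ p)) ∧
  (∃ Z : Set ℝ, volume Z = 0 ∧ ∀ R : ℝ, 0 < R →
    Tendsto (fun t => ∫ x in Metric.closedBall (0 : Euc n) R, |u (t, x) - u₀ x|)
      (nhdsWithin 0 (Set.Icc 0 T \ Z)) (nhds 0))


section KatoGeneral

open Topology

lemma kato_measurable_sign : Measurable Real.sign := by
  unfold Real.sign
  exact Measurable.ite measurableSet_Iio measurable_const
    (Measurable.ite measurableSet_Ioi measurable_const measurable_const)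

lemma kato_abs_sign_le (r : ℝ) : |Real.sign r| ≤ 1 := by
  rcases Real.sign_apply_eq r with h | h | h <;> simp [h]

lemma kato_sign_mul_self (r : ℝ) : Real.sign r * r = |r| := by
  rcases lt_trichotomy r 0 with h | h | h
  · rw [Real.sign_of_neg h, abs_of_neg h]; ring
  · simp [h]
  · rw [Real.sign_of_pos h, abs_of_pos h]; ring

lemma kato_sign_tendsto {ι : Type*} {l : Filter ι} {b X : ι → ℝ} {a b0 X0 : ℝ}
    (hb : Tendsto b l (𝓝 b0)) (hX : Tendsto X l (𝓝 X0)) (h0 : a = b0 → X0 = 0) :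
    Tendsto (fun k => Real.sign (a - b k) * X k) l (𝓝 (Real.sign (a - b0) * X0)) := by
  have hs : Tendsto (fun k => a - b k) l (𝓝 (a - b0)) := tendsto_const_nhds.sub hb
  rcases lt_trichotomy (a - b0) 0 with h | h | h
  · refine Tendsto.mul ?_ hX
    refine tendsto_const_nhds.congr' ?_
    filter_upwards [hs.eventually (gt_mem_nhds h)] with k hk
    rw [Real.sign_of_neg h, Real.sign_of_neg hk]
  · have hX0 := h0 (by linarith)
    subst hX0
    rw [mul_zero]
    refine squeeze_zero_norm (a := fun k => |X k|) (fun k => ?_) (by simpa using hX.abs)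
    rw [Real.norm_eq_abs, abs_mul]
    exact mul_le_of_le_one_left (abs_nonneg _) (kato_abs_sign_le _)
  · refine Tendsto.mul ?_ hX
    refine tendsto_const_nhds.congr' ?_
    filter_upwards [hs.eventually (lt_mem_nhds h)] with k hk
    rw [Real.sign_of_pos h, Real.sign_of_pos hk]

lemma kato_bound {X : Type*} [TopologicalSpace X] (H : X × ℝ × ℝ → ℝ) (hH : Continuous H)
    (K : Set X) (hK : IsCompact K) (C : ℝ) (hz : ∀ x ∉ K, ∀ a b, H (x, a, b) = 0) :
    ∃ B : ℝ, 0 ≤ B ∧ ∀ x a b, |a| ≤ C → |b| ≤ C → |H (x, a, b)| ≤ K.indicator (fun _ => B) x := by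
  obtain ⟨B, hB⟩ := (hK.prod ((isCompact_Icc (a := -C) (b := C)).prod
    (isCompact_Icc (a := -C) (b := C)))).exists_bound_of_continuousOn hH.continuousOn
  refine ⟨max B 0, le_max_right _ _, fun x a b ha hb => ?_⟩
  by_cases hx : x ∈ K
  · rw [indicator_of_mem hx]
    exact (hB (x, a, b) ⟨hx, abs_le.1 ha, abs_le.1 hb⟩).trans (le_max_left _ _)
  · rw [indicator_of_notMem hx, hz x hx]; simp

lemma kato_sign_meas {X : Type*} [TopologicalSpace X] [SecondCountableTopology X]
    [MeasurableSpace X] [BorelSpace X]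
    (a b : X → ℝ) (ha : Measurable a) (hb : Measurable b)
    (H : X × ℝ × ℝ → ℝ) (hH : Continuous H) :
    Measurable (fun x => Real.sign (a x - b x) * H (x, a x, b x)) :=
  (kato_measurable_sign.comp (ha.sub hb)).mul
    (hH.measurable.comp (measurable_id.prodMk (ha.prodMk hb)))

lemma kato_integrable {X : Type*} [TopologicalSpace X] [SecondCountableTopology X] [T2Space X]
    [MeasurableSpace X] [BorelSpace X] (μ : Measure X) [IsFiniteMeasureOnCompacts μ]
    (a b : X → ℝ) (ha : Measurable a) (hb : Measurable b) (C : ℝ)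
    (haC : ∀ x, |a x| ≤ C) (hbC : ∀ x, |b x| ≤ C)
    (H : X × ℝ × ℝ → ℝ) (hH : Continuous H)
    (K : Set X) (hK : IsCompact K) (hz : ∀ x ∉ K, ∀ a b, H (x, a, b) = 0) :
    Integrable (fun x => Real.sign (a x - b x) * H (x, a x, b x)) μ := by
  obtain ⟨B, hB0, hB⟩ := kato_bound H hH K hK C hz
  refine Integrable.mono' (g := K.indicator (fun _ => B)) ?_
    (kato_sign_meas a b ha hb H hH).aestronglyMeasurable (ae_of_all _ fun x => ?_)
  · exact (integrable_indicator_iff hK.measurableSet).2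
      (integrableOn_const hK.measure_lt_top.ne)
  · rw [Real.norm_eq_abs, abs_mul]
    exact (mul_le_of_le_one_left (abs_nonneg _) (kato_abs_sign_le _)).trans
      (hB _ _ _ (haC x) (hbC x))

variable {E : Type*} [NormedAddCommGroup E] [NormedSpace ℝ E] [FiniteDimensional ℝ E]
  [MeasurableSpace E] [BorelSpace E] (μ : Measure E) [μ.IsAddHaarMeasure]

lemma kato_translation (w : E → ℝ) (hw : Integrable w μ) (e : ℕ → E)
    (he : Tendsto e atTop (𝓝 0)) :
    Tendsto (fun k => ∫⁻ p, ‖w (p - e k) - w p‖ₑ ∂μ) atTop (𝓝 0) := by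
  have : Fact ((1:ENNReal) ≠ ⊤) := ⟨ENNReal.one_ne_top⟩
  have hm : MemLp w 1 μ := memLp_one_iff_integrable.2 hw
  have hc : Continuous (fun h : E => (DomAddAct.mk h +ᵥ hm.toLp w : Lp ℝ 1 μ)) := by
    have h1 : Continuous (fun h : E => DomAddAct.mk h) := DomAddAct.continuous_mk
    exact h1.vadd continuous_const
  have hneg : Tendsto (fun k => -e k) atTop (𝓝 0) := by simpa using he.neg
  have h2 := (tendsto_iff_edist_tendsto_0.1 ((hc.tendsto 0).comp hneg))
  refine h2.congr fun k => ?_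
  simp only [Function.comp]
  rw [DomAddAct.mk_vadd_toLp, DomAddAct.mk_vadd_toLp, Lp.edist_toLp_toLp,
    eLpNorm_one_eq_lintegral_enorm]
  refine lintegral_congr fun p => ?_
  simp [sub_eq_neg_add]

lemma kato_subseq (v : E → ℝ) (hv : Measurable v) (C : ℝ) (hC : ∀ p, |v p| ≤ C) (R : ℝ)
    (e : ℕ → ℝ) (he : Tendsto e atTop (𝓝 0)) (he1 : ∀ k, |e k| ≤ 1) :
    ∃ ns : ℕ → ℕ, StrictMono ns ∧
      ∀ᵐ x ∂((μ.prod μ).restrict (Metric.closedBall 0 1 ×ˢ Metric.closedBall 0 R)),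
        Tendsto (fun k => v (x.2 - e (ns k) • x.1)) atTop (𝓝 (v x.2)) := by
  set w : E → ℝ := (Metric.closedBall (0:E) (R + 1)).indicator v with hwdef
  have hwm : Measurable w := hv.indicator Metric.isClosed_closedBall.measurableSet
  have hw : Integrable w μ := by
    refine Integrable.mono' (g := (Metric.closedBall (0:E) (R + 1)).indicator (fun _ => C)) ?_
      hwm.aestronglyMeasurable (ae_of_all _ fun x => ?_)
    · exact (integrable_indicator_iff Metric.isClosed_closedBall.measurableSet).2
        (integrableOn_const (isCompact_closedBall _ _).measure_lt_top.ne)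
    · rw [hwdef]
      by_cases hx : x ∈ Metric.closedBall (0:E) (R + 1)
      · rw [indicator_of_mem hx, indicator_of_mem hx]; exact hC x
      · rw [indicator_of_notMem hx, indicator_of_notMem hx]; simp
  set B := Metric.closedBall (0:E) 1
  set D := Metric.closedBall (0:E) R
  have hmeas : ∀ k, Measurable (fun x : E × E => w (x.2 - e k • x.1)) := fun k =>
    hwm.comp (by fun_prop)
  have h1 : Tendsto (fun k => ∫⁻ z in B, ∫⁻ p in D, ‖w (p - e k • z) - w p‖ₑ ∂μ ∂μ) atTop
      (𝓝 0) := by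
    have h2 : Tendsto (fun k => ∫⁻ z in B, ∫⁻ p in D, ‖w (p - e k • z) - w p‖ₑ ∂μ ∂μ) atTop
      (𝓝 (∫⁻ z in B, 0 ∂μ)) := by
      refine tendsto_lintegral_of_dominated_convergence
        (fun _ => 2 * ∫⁻ p, ‖w p‖ₑ ∂μ) ?_ ?_ ?_ ?_
      · intro k
        refine Measurable.lintegral_prod_right' (f := fun x : E × E =>
          ‖w (x.2 - e k • x.1) - w x.2‖ₑ) ?_
        exact ((hmeas k).sub (hwm.comp measurable_snd)).enorm
      · intro k
        refine ae_of_all _ fun z => ?_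
        calc ∫⁻ p in D, ‖w (p - e k • z) - w p‖ₑ ∂μ
            ≤ ∫⁻ p, ‖w (p - e k • z) - w p‖ₑ ∂μ := setLIntegral_le_lintegral _ _
          _ ≤ ∫⁻ p, (‖w (p - e k • z)‖ₑ + ‖w p‖ₑ) ∂μ := lintegral_mono fun p => enorm_sub_le
          _ = ∫⁻ p, ‖w (p - e k • z)‖ₑ ∂μ + ∫⁻ p, ‖w p‖ₑ ∂μ :=
              lintegral_add_right _ hwm.enorm
          _ = 2 * ∫⁻ p, ‖w p‖ₑ ∂μ := by
              rw [lintegral_sub_right_eq_self (fun p => ‖w p‖ₑ) (e k • z), two_mul]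
      · rw [lintegral_const]
        refine ENNReal.mul_ne_top (ENNReal.mul_ne_top ENNReal.ofNat_ne_top hw.2.ne) ?_
        rw [Measure.restrict_apply_univ]
        exact (isCompact_closedBall _ _).measure_lt_top.ne
      · refine ae_of_all _ fun z => ?_
        refine tendsto_of_tendsto_of_tendsto_of_le_of_le tendsto_const_nhds
          (kato_translation μ w hw (fun k => e k • z) (by simpa using he.smul_const z))
          (fun _ => zero_le) (fun _ => setLIntegral_le_lintegral _ _)
    simpa using h2
  have h3 : TendstoInMeasure ((μ.prod μ).restrict (B ×ˢ D))
      (fun k (x : E × E) => w (x.2 - e k • x.1)) atTop (fun x => w x.2) := by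
    refine tendstoInMeasure_of_tendsto_eLpNorm (p := 1) one_ne_zero
      (fun k => (hmeas k).aestronglyMeasurable)
      (hwm.comp measurable_snd).aestronglyMeasurable ?_
    refine h1.congr fun k => ?_
    rw [eLpNorm_one_eq_lintegral_enorm, ← Measure.prod_restrict, lintegral_prod]
    · rfl
    · exact ((hmeas k).sub (hwm.comp measurable_snd)).enorm.aemeasurable
  obtain ⟨ns, hns, hlim⟩ := h3.exists_seq_tendsto_ae
  refine ⟨ns, hns, ?_⟩
  have hmem : ∀ᵐ x ∂((μ.prod μ).restrict (B ×ˢ D)), x ∈ B ×ˢ D :=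
    ae_restrict_mem (Metric.isClosed_closedBall.measurableSet.prod
      Metric.isClosed_closedBall.measurableSet)
  filter_upwards [hlim, hmem] with x hx hxm
  have hx1 : ‖x.1‖ ≤ 1 := by simpa [B] using hxm.1
  have hx2 : ‖x.2‖ ≤ R := by simpa [D] using hxm.2
  have hw2 : w x.2 = v x.2 := indicator_of_mem (by simp; linarith) _
  rw [← hw2]
  refine hx.congr fun k => indicator_of_mem ?_ _
  rw [mem_closedBall_zero_iff]
  refine (norm_sub_le _ _).trans (add_le_add hx2 ?_)
  rw [norm_smul, Real.norm_eq_abs]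
  exact mul_le_one₀ (he1 _) (norm_nonneg _) hx1

end KatoGeneral

instance kato_isAddHaar (n : ℕ) : (volume : Measure (ℝ × Euc n)).IsAddHaarMeasure := by
  rw [Measure.volume_eq_prod]
  infer_instance

section KatoGeneral2

open Topology

lemma kato_limit {E : Type*} [NormedAddCommGroup E] [NormedSpace ℝ E] [FiniteDimensional ℝ E]
    [MeasurableSpace E] [BorelSpace E] (μ : Measure E) [μ.IsAddHaarMeasure]
    (u v : E → ℝ) (hu : Measurable u) (hv : Measurable v) (C : ℝ)
    (huC : ∀ p, |u p| ≤ C) (hvC : ∀ p, |v p| ≤ C) (R : ℝ)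
    (H : ℝ × E × E × ℝ × ℝ → ℝ) (hH : Continuous H)
    (hz : ∀ ε z p a b, ¬ (z ∈ Metric.closedBall (0:E) 1 ∧ p ∈ Metric.closedBall (0:E) R) →
      H (ε, z, p, a, b) = 0)
    (hd : ∀ z p a, H (0, z, p, a, a) = 0)
    (e : ℕ → ℝ) (he : Tendsto e atTop (𝓝 0)) (he1 : ∀ k, |e k| ≤ 1)
    (hpos : ∀ k, 0 ≤ ∫ x : E × E, Real.sign (u x.2 - v (x.2 - e k • x.1)) *
      H (e k, x.1, x.2, u x.2, v (x.2 - e k • x.1)) ∂(μ.prod μ)) :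
    0 ≤ ∫ x : E × E, Real.sign (u x.2 - v x.2) *
      H (0, x.1, x.2, u x.2, v x.2) ∂(μ.prod μ) := by
  obtain ⟨ns, hns, hae⟩ := kato_subseq μ v hv C hvC R e he he1
  set K : Set (E × E) := Metric.closedBall 0 1 ×ˢ Metric.closedBall 0 R with hKdef
  have hK : IsCompact K := (isCompact_closedBall _ _).prod (isCompact_closedBall _ _)
  obtain ⟨B, hB⟩ := ((isCompact_Icc (a := (-1:ℝ)) (b := 1)).prod
    ((isCompact_closedBall (0:E) 1).prod ((isCompact_closedBall (0:E) R).prod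
    ((isCompact_Icc (a := -C) (b := C)).prod
    (isCompact_Icc (a := -C) (b := C)))))).exists_bound_of_continuousOn hH.continuousOn
  have hlim : Tendsto (fun k => ∫ x : E × E, Real.sign (u x.2 - v (x.2 - e (ns k) • x.1)) *
      H (e (ns k), x.1, x.2, u x.2, v (x.2 - e (ns k) • x.1)) ∂(μ.prod μ)) atTop
      (𝓝 (∫ x : E × E, Real.sign (u x.2 - v x.2) *
      H (0, x.1, x.2, u x.2, v x.2) ∂(μ.prod μ))) := by
    refine tendsto_integral_of_dominated_convergence (K.indicator (fun _ => B)) ?_ ?_ ?_ ?_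
    · intro k
      exact (kato_sign_meas (X := E × E) (fun x => u x.2) (fun x => v (x.2 - e (ns k) • x.1))
        (hu.comp measurable_snd) (hv.comp (by fun_prop))
        (fun y => H (e (ns k), y.1.1, y.1.2, y.2.1, y.2.2))
        (hH.comp (by fun_prop))).aestronglyMeasurable
    · exact (integrable_indicator_iff hK.measurableSet).2
        (integrableOn_const hK.measure_lt_top.ne)
    · intro k
      refine ae_of_all _ fun x => ?_
      by_cases hx : x ∈ K
      · rw [indicator_of_mem hx, Real.norm_eq_abs, abs_mul]
        refine (mul_le_of_le_one_left (abs_nonneg _) (kato_abs_sign_le _)).trans ?_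
        exact hB _ ⟨abs_le.1 (he1 _), hx.1, hx.2, abs_le.1 (huC _), abs_le.1 (hvC _)⟩
      · rw [indicator_of_notMem hx, hz _ _ _ _ _ hx]; simp
    · rw [ae_restrict_iff' hK.measurableSet] at hae
      filter_upwards [hae] with x hx
      by_cases hxK : x ∈ K
      · have hvx := hx hxK
        refine kato_sign_tendsto hvx ?_ ?_
        · have h0 := (he.comp hns.tendsto_atTop)
          refine (hH.tendsto (0, x.1, x.2, u x.2, v x.2)).comp ?_
          exact h0.prodMk_nhds (tendsto_const_nhds.prodMk_nhds
            (tendsto_const_nhds.prodMk_nhds (tendsto_const_nhds.prodMk_nhds hvx)))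
        · intro h; rw [h]; exact hd _ _ _
      · simp [hz _ _ _ _ _ hxK]
  exact ge_of_tendsto' hlim fun k => hpos _

lemma kato_fderiv_zero {E : Type*} [NormedAddCommGroup E] [NormedSpace ℝ E] (ψ : E → ℝ)
    (h0 : ∀ p, 0 ≤ ψ p) (p : E) (hp : ψ p = 0) : fderiv ℝ ψ p = 0 := by
  refine IsLocalMin.fderiv_eq_zero ?_
  exact Filter.Eventually.of_forall fun q => by rw [hp]; exact h0 q

/-- averaged difference quotient -/
def katoQ {n : ℕ} (F : ℝ × Euc n × ℝ → ℝ) (ε : ℝ) (z p : ℝ × Euc n) (a : ℝ) : ℝ :=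
  ∫ s in (0:ℝ)..1, fderiv ℝ F (p.1 - (s * ε) * z.1, p.2 - (s * ε) • z.2, a) (z.1, z.2, 0)

lemma katoQ_cont {n : ℕ} (F : ℝ × Euc n × ℝ → ℝ) (hF : ContDiff ℝ 1 F) :
    Continuous (fun y : ℝ × (ℝ × Euc n) × (ℝ × Euc n) × ℝ =>
      katoQ F y.1 y.2.1 y.2.2.1 y.2.2.2) := by
  unfold katoQ
  refine intervalIntegral.continuous_parametric_intervalIntegral_of_continuous' ?_ _ _
  have h1 : Continuous (fderiv ℝ F) := hF.continuous_fderiv one_ne_zero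
  refine (h1.comp ?_).clm_apply ?_ <;> fun_prop

lemma katoQ_zero {n : ℕ} (F : ℝ × Euc n × ℝ → ℝ) (z p : ℝ × Euc n) (a : ℝ) :
    katoQ F 0 z p a = fderiv ℝ F (p.1, p.2, a) (z.1, z.2, 0) := by
  simp [katoQ]

lemma katoQ_eq {n : ℕ} (F : ℝ × Euc n × ℝ → ℝ) (hF : ContDiff ℝ 1 F) (ε : ℝ) (hε : ε ≠ 0)
    (z p : ℝ × Euc n) (a : ℝ) :
    katoQ F ε z p a = ε⁻¹ * (F (p.1, p.2, a) - F ((p - ε • z).1, (p - ε • z).2, a)) := by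
  have h1 : Continuous (fderiv ℝ F) := hF.continuous_fderiv one_ne_zero
  have hder : ∀ s : ℝ, HasDerivAt
      (fun s : ℝ => F (p.1 - (s * ε) * z.1, p.2 - (s * ε) • z.2, a))
      (fderiv ℝ F (p.1 - (s * ε) * z.1, p.2 - (s * ε) • z.2, a) (-(ε • (z.1, z.2, (0:ℝ))))) s := by
    intro s
    have hin : HasDerivAt (fun s : ℝ => (p.1 - (s * ε) * z.1, p.2 - (s * ε) • z.2, a))
        (-(ε • (z.1, z.2, (0:ℝ)))) s := by
      have ha : HasDerivAt (fun s : ℝ => s * ε) ε s := by simpa using (hasDerivAt_id s).mul_const ε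
      have hb := (ha.mul_const z.1).const_sub p.1
      have hc := (ha.smul_const z.2).const_sub p.2
      have hd := hb.prodMk (hc.prodMk (hasDerivAt_const s a))
      convert hd using 1
      simp
    exact (hF.differentiable one_ne_zero _).hasFDerivAt.comp_hasDerivAt s hin
  have hint := intervalIntegral.integral_eq_sub_of_hasDerivAt (a := 0) (b := 1)
    (fun s _ => hder s) (by
      refine Continuous.intervalIntegrable ?_ _ _
      refine (h1.comp ?_).clm_apply ?_ <;> fun_prop)
  have h2 : ∫ s in (0:ℝ)..1, fderiv ℝ F (p.1 - (s * ε) * z.1, p.2 - (s * ε) • z.2, a)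
      (-(ε • (z.1, z.2, (0:ℝ)))) = -ε * katoQ F ε z p a := by
    rw [katoQ, ← intervalIntegral.integral_const_mul]
    congr 1
    ext s
    rw [map_neg, map_smul, smul_eq_mul]; ring
  rw [h2] at hint
  simp only [one_mul, zero_mul, sub_zero, zero_smul] at hint
  rw [eq_inv_mul_iff_mul_eq₀ hε]
  simp only [Prod.fst_sub, Prod.snd_sub, Prod.smul_fst, Prod.smul_snd, smul_eq_mul]
  linarith

end KatoGeneral2

section KatoDoubling

variable {n : ℕ}

/-- The doubled-variable integrand without the sign. -/
def katoH (f : Fin n → ℝ × Euc n × ℝ → ℝ) (g : ℝ × Euc n × ℝ → ℝ) (φ ρ : ℝ × Euc n → ℝ)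
    (y : ℝ × (ℝ × Euc n) × (ℝ × Euc n) × ℝ × ℝ) : ℝ :=
  ρ y.2.1 * ((y.2.2.2.1 - y.2.2.2.2) * fderiv ℝ φ y.2.2.1 (1, 0)
    + ∑ i, (f i (y.2.2.1.1, y.2.2.1.2, y.2.2.2.1) - f i (y.2.2.1.1, y.2.2.1.2, y.2.2.2.2))
        * fderiv ℝ φ y.2.2.1 (0, EuclideanSpace.single i 1)
    + (g (y.2.2.1.1, y.2.2.1.2, y.2.2.2.1)
        - g ((y.2.2.1 - y.1 • y.2.1).1, (y.2.2.1 - y.1 • y.2.1).2, y.2.2.2.2)) * φ y.2.2.1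
    + (∑ i, (fderiv ℝ (f i) ((y.2.2.1 - y.1 • y.2.1).1, (y.2.2.1 - y.1 • y.2.1).2, y.2.2.2.1)
            (0, EuclideanSpace.single i 1, 0)
          - fderiv ℝ (f i) (y.2.2.1.1, y.2.2.1.2, y.2.2.2.2)
            (0, EuclideanSpace.single i 1, 0))) * φ y.2.2.1)
  + (∑ i, fderiv ℝ ρ y.2.1 (0, EuclideanSpace.single i 1)
      * (katoQ (f i) y.1 y.2.1 y.2.2.1 y.2.2.2.1 - katoQ (f i) y.1 y.2.1 y.2.2.1 y.2.2.2.2))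
      * φ y.2.2.1

lemma katoH_cont (f : Fin n → ℝ × Euc n × ℝ → ℝ) (g : ℝ × Euc n × ℝ → ℝ) (φ ρ : ℝ × Euc n → ℝ)
    (hf : ∀ i, ContDiff ℝ 1 (f i)) (hg : Continuous g)
    (hφ : ContDiff ℝ (⊤ : ℕ∞) φ) (hρ : ContDiff ℝ (⊤ : ℕ∞) ρ) :
    Continuous (katoH f g φ ρ) := by
  have h1 : ∀ i, Continuous (fderiv ℝ (f i)) := fun i => (hf i).continuous_fderiv one_ne_zero
  have h2 : Continuous (fderiv ℝ φ) := hφ.continuous_fderiv (by simp)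
  have h3 : Continuous (fderiv ℝ ρ) := hρ.continuous_fderiv (by simp)
  have h4 := fun i => (hf i).continuous
  have h5 := hφ.continuous
  have h6 := hρ.continuous
  have h7 : ∀ i, Continuous (fun y : ℝ × (ℝ × Euc n) × (ℝ × Euc n) × ℝ × ℝ =>
      katoQ (f i) y.1 y.2.1 y.2.2.1 y.2.2.2.1) := fun i =>
    (katoQ_cont (f i) (hf i)).comp (g := fun y => _)
      (f := fun y : ℝ × (ℝ × Euc n) × (ℝ × Euc n) × ℝ × ℝ => (y.1, y.2.1, y.2.2.1, y.2.2.2.1))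
      (by fun_prop)
  have h8 : ∀ i, Continuous (fun y : ℝ × (ℝ × Euc n) × (ℝ × Euc n) × ℝ × ℝ =>
      katoQ (f i) y.1 y.2.1 y.2.2.1 y.2.2.2.2) := fun i =>
    (katoQ_cont (f i) (hf i)).comp (g := fun y => _)
      (f := fun y : ℝ × (ℝ × Euc n) × (ℝ × Euc n) × ℝ × ℝ => (y.1, y.2.1, y.2.2.1, y.2.2.2.2))
      (by fun_prop)
  unfold katoH
  fun_prop

lemma kato_entropy_full (T : ℝ)
    (f : Fin n → ℝ × Euc n × ℝ → ℝ) (g : ℝ × Euc n × ℝ → ℝ)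
    (u : ℝ × Euc n → ℝ) (u₀ : Euc n → ℝ) (hu : IsEntropySol n T f g u u₀)
    (k : ℝ) (ψ : ℝ × Euc n → ℝ) (hψ : ContDiff ℝ (⊤ : ℕ∞) ψ) (hc : HasCompactSupport ψ)
    (h0 : ∀ p, 0 ≤ ψ p) (hs : ∀ p : ℝ × Euc n, p.1 ∉ Set.Ioo 0 T → ψ p = 0) :
    0 ≤ ∫ p, Real.sign (u p - k) * ((u p - k) * fderiv ℝ ψ p (1, 0)
      + ∑ i, (f i (p.1, p.2, u p) - f i (p.1, p.2, k))
          * fderiv ℝ ψ p (0, EuclideanSpace.single i 1)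
      + (-(∑ i, fderiv ℝ (f i) (p.1, p.2, k) (0, EuclideanSpace.single i 1, 0))
          + g (p.1, p.2, u p)) * ψ p) := by
  have h := hu.2.2.1 k ψ hψ hc h0 hs
  rw [setIntegral_eq_integral_of_forall_compl_eq_zero] at h
  · refine h.trans_eq (integral_congr_ae (ae_of_all _ fun p => ?_))
    simp only [← kato_sign_mul_self]
    simp only [mul_assoc, ← Finset.mul_sum]
    ring
  · intro p hp
    have hp1 : p.1 ∉ Set.Ioo 0 T := fun h => hp ⟨h, mem_univ _⟩
    rw [kato_fderiv_zero ψ h0 p (hs p hp1), hs p hp1]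
    simp

end KatoDoubling

section KatoDoubling2

variable {n : ℕ}

/-- derivative in the first variable of the doubled test function. -/
def katoD1 (φ ρ : ℝ × Euc n → ℝ) (ε : ℝ) (p q w : ℝ × Euc n) : ℝ :=
  ρ (ε⁻¹ • (p - q)) * fderiv ℝ φ p w + φ p * (ε⁻¹ * fderiv ℝ ρ (ε⁻¹ • (p - q)) w)

/-- derivative in the second variable of the doubled test function. -/
def katoD2 (φ ρ : ℝ × Euc n → ℝ) (ε : ℝ) (p q w : ℝ × Euc n) : ℝ :=
  -(φ p * (ε⁻¹ * fderiv ℝ ρ (ε⁻¹ • (p - q)) w))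

lemma katoD1_eq (φ ρ : ℝ × Euc n → ℝ) (ε : ℝ) (p q w : ℝ × Euc n)
    (hφ : ContDiff ℝ (⊤ : ℕ∞) φ) (hρ : ContDiff ℝ (⊤ : ℕ∞) ρ) :
    fderiv ℝ (fun p' => φ p' * ρ (ε⁻¹ • (p' - q))) p w = katoD1 φ ρ ε p q w := by
  have h1 : HasFDerivAt φ (fderiv ℝ φ p) p := (hφ.differentiable (by simp) p).hasFDerivAt
  have h2 : HasFDerivAt ρ (fderiv ℝ ρ (ε⁻¹ • (p - q))) (ε⁻¹ • (p - q)) :=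
    (hρ.differentiable (by simp) _).hasFDerivAt
  have h3 : HasFDerivAt (fun p' : ℝ × Euc n => ε⁻¹ • (p' - q))
      (ε⁻¹ • ContinuousLinearMap.id ℝ (ℝ × Euc n)) p := ((hasFDerivAt_id p).sub_const q).const_smul ε⁻¹
  have h4 := h1.mul (h2.comp p h3)
  have h5 := h4.fderiv
  simp only [Function.comp_def] at h5
  change fderiv ℝ (fun p' => φ p' * ρ (ε⁻¹ • (p' - q))) p = _ at h5
  rw [h5]
  simp [katoD1]
  ring

lemma katoD2_eq (φ ρ : ℝ × Euc n → ℝ) (ε : ℝ) (p q w : ℝ × Euc n)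
    (hρ : ContDiff ℝ (⊤ : ℕ∞) ρ) :
    fderiv ℝ (fun q' => φ p * ρ (ε⁻¹ • (p - q'))) q w = katoD2 φ ρ ε p q w := by
  have h2 : HasFDerivAt ρ (fderiv ℝ ρ (ε⁻¹ • (p - q))) (ε⁻¹ • (p - q)) :=
    (hρ.differentiable (by simp) _).hasFDerivAt
  have h3 : HasFDerivAt (fun q' : ℝ × Euc n => ε⁻¹ • (p - q'))
      (ε⁻¹ • (-ContinuousLinearMap.id ℝ (ℝ × Euc n))) q :=
    ((hasFDerivAt_id q).const_sub p).const_smul ε⁻¹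
  have h4 := (h2.comp q h3).const_mul (φ p)
  have h5 := h4.fderiv
  simp only [Function.comp_def] at h5
  rw [h5]
  simp [katoD2]

/-- integrand from the inequality of `u`. -/
def katoA (f : Fin n → ℝ × Euc n × ℝ → ℝ) (g : ℝ × Euc n × ℝ → ℝ) (φ ρ : ℝ × Euc n → ℝ) (ε : ℝ)
    (y : ((ℝ × Euc n) × (ℝ × Euc n)) × ℝ × ℝ) : ℝ :=
  (y.2.1 - y.2.2) * katoD1 φ ρ ε y.1.1 y.1.2 (1, 0)
      + ∑ i, (f i (y.1.1.1, y.1.1.2, y.2.1) - f i (y.1.1.1, y.1.1.2, y.2.2))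
          * katoD1 φ ρ ε y.1.1 y.1.2 (0, EuclideanSpace.single i 1)
      + (-(∑ i, fderiv ℝ (f i) (y.1.1.1, y.1.1.2, y.2.2) (0, EuclideanSpace.single i 1, 0))
          + g (y.1.1.1, y.1.1.2, y.2.1)) * (φ y.1.1 * ρ (ε⁻¹ • (y.1.1 - y.1.2)))

/-- integrand from the inequality of `v`. -/
def katoB (f : Fin n → ℝ × Euc n × ℝ → ℝ) (g : ℝ × Euc n × ℝ → ℝ) (φ ρ : ℝ × Euc n → ℝ) (ε : ℝ)
    (y : ((ℝ × Euc n) × (ℝ × Euc n)) × ℝ × ℝ) : ℝ :=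
  (y.2.1 - y.2.2) * katoD2 φ ρ ε y.1.1 y.1.2 (1, 0)
      + ∑ i, (f i (y.1.2.1, y.1.2.2, y.2.1) - f i (y.1.2.1, y.1.2.2, y.2.2))
          * katoD2 φ ρ ε y.1.1 y.1.2 (0, EuclideanSpace.single i 1)
      + ((∑ i, fderiv ℝ (f i) (y.1.2.1, y.1.2.2, y.2.1) (0, EuclideanSpace.single i 1, 0))
          - g (y.1.2.1, y.1.2.2, y.2.2)) * (φ y.1.1 * ρ (ε⁻¹ • (y.1.1 - y.1.2)))

lemma katoAB_cont (f : Fin n → ℝ × Euc n × ℝ → ℝ) (g : ℝ × Euc n × ℝ → ℝ) (φ ρ : ℝ × Euc n → ℝ)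
    (ε : ℝ) (hf : ∀ i, ContDiff ℝ 1 (f i)) (hg : Continuous g)
    (hφ : ContDiff ℝ (⊤ : ℕ∞) φ) (hρ : ContDiff ℝ (⊤ : ℕ∞) ρ) :
    Continuous (katoA f g φ ρ ε) ∧ Continuous (katoB f g φ ρ ε) := by
  have h1 : ∀ i, Continuous (fderiv ℝ (f i)) := fun i => (hf i).continuous_fderiv one_ne_zero
  have h2 : Continuous (fderiv ℝ φ) := hφ.continuous_fderiv (by simp)
  have h3 : Continuous (fderiv ℝ ρ) := hρ.continuous_fderiv (by simp)
  have h4 := fun i => (hf i).continuous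
  have h5 := hφ.continuous
  have h6 := hρ.continuous
  constructor
  · unfold katoA katoD1
    fun_prop
  · unfold katoB katoD2
    fun_prop

/-- pointwise identity after rescaling -/
lemma katoAB_eq (f : Fin n → ℝ × Euc n × ℝ → ℝ) (g : ℝ × Euc n × ℝ → ℝ) (φ ρ : ℝ × Euc n → ℝ)
    (ε : ℝ) (hε : 0 < ε) (hf : ∀ i, ContDiff ℝ 1 (f i)) (z p : ℝ × Euc n) (a b : ℝ) :
    katoA f g φ ρ ε ((p, p - ε • z), a, b) + katoB f g φ ρ ε ((p, p - ε • z), a, b)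
      = katoH f g φ ρ (ε, z, p, a, b) := by
  have hz : ε⁻¹ • (p - (p - ε • z)) = z := by
    rw [sub_sub_cancel, inv_smul_smul₀ hε.ne']
  simp only [katoA, katoB, katoH, katoD1, katoD2, hz, katoQ_eq _ (hf _) ε hε.ne']
  have e1 : ∀ i, (f i (p.1, p.2, a) - f i (p.1, p.2, b)) *
        (ρ z * fderiv ℝ φ p (0, EuclideanSpace.single i 1)
          + φ p * (ε⁻¹ * fderiv ℝ ρ z (0, EuclideanSpace.single i 1)))
      = ρ z * ((f i (p.1, p.2, a) - f i (p.1, p.2, b)) *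
          fderiv ℝ φ p (0, EuclideanSpace.single i 1)) +
        φ p * ε⁻¹ * (fderiv ℝ ρ z (0, EuclideanSpace.single i 1) * f i (p.1, p.2, a)) -
        φ p * ε⁻¹ * (fderiv ℝ ρ z (0, EuclideanSpace.single i 1) * f i (p.1, p.2, b)) := by
    intro i; ring
  have e2 : ∀ i, (f i ((p - ε • z).1, (p - ε • z).2, a) - f i ((p - ε • z).1, (p - ε • z).2, b)) *
        -(φ p * (ε⁻¹ * fderiv ℝ ρ z (0, EuclideanSpace.single i 1)))
      = φ p * ε⁻¹ * (fderiv ℝ ρ z (0, EuclideanSpace.single i 1)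
            * f i ((p - ε • z).1, (p - ε • z).2, b)) -
        φ p * ε⁻¹ * (fderiv ℝ ρ z (0, EuclideanSpace.single i 1)
            * f i ((p - ε • z).1, (p - ε • z).2, a)) := by
    intro i; ring
  have e3 : ∀ i, fderiv ℝ ρ z (0, EuclideanSpace.single i 1) *
      (ε⁻¹ * (f i (p.1, p.2, a) - f i ((p - ε • z).1, (p - ε • z).2, a)) -
       ε⁻¹ * (f i (p.1, p.2, b) - f i ((p - ε • z).1, (p - ε • z).2, b)))
      = ε⁻¹ * (fderiv ℝ ρ z (0, EuclideanSpace.single i 1) * f i (p.1, p.2, a)) -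
        ε⁻¹ * (fderiv ℝ ρ z (0, EuclideanSpace.single i 1) * f i (p.1, p.2, b)) +
        ε⁻¹ * (fderiv ℝ ρ z (0, EuclideanSpace.single i 1)
            * f i ((p - ε • z).1, (p - ε • z).2, b)) -
        ε⁻¹ * (fderiv ℝ ρ z (0, EuclideanSpace.single i 1)
            * f i ((p - ε • z).1, (p - ε • z).2, a)) := by
    intro i; ring
  simp only [e1, e2, e3, Finset.sum_add_distrib, Finset.sum_sub_distrib, ← Finset.mul_sum]
  ring

lemma katoH_zero (f : Fin n → ℝ × Euc n × ℝ → ℝ) (g : ℝ × Euc n × ℝ → ℝ) (φ ρ : ℝ × Euc n → ℝ)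
    (ε : ℝ) (z p : ℝ × Euc n) (a b : ℝ) (h : ¬ (z ∈ tsupport ρ ∧ p ∈ tsupport φ)) :
    katoH f g φ ρ (ε, z, p, a, b) = 0 := by
  by_cases hz : z ∈ tsupport ρ
  · have hp : p ∉ tsupport φ := fun hp => h ⟨hz, hp⟩
    have h1 : φ p = 0 := image_eq_zero_of_notMem_tsupport hp
    have h2 : fderiv ℝ φ p = 0 := by
      by_contra hne
      exact hp (support_fderiv_subset ℝ hne)
    simp [katoH, h1, h2]
  · have h1 : ρ z = 0 := image_eq_zero_of_notMem_tsupport hz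
    have h2 : fderiv ℝ ρ z = 0 := by
      by_contra hne
      exact hz (support_fderiv_subset ℝ hne)
    simp [katoH, h1, h2]

lemma katoAB_zero (f : Fin n → ℝ × Euc n × ℝ → ℝ) (g : ℝ × Euc n × ℝ → ℝ) (φ ρ : ℝ × Euc n → ℝ)
    (ε : ℝ) (p q : ℝ × Euc n) (a b : ℝ)
    (h : ¬ (ε⁻¹ • (p - q) ∈ tsupport ρ ∧ p ∈ tsupport φ)) :
    katoA f g φ ρ ε ((p, q), a, b) = 0 ∧ katoB f g φ ρ ε ((p, q), a, b) = 0 := by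
  by_cases hz : ε⁻¹ • (p - q) ∈ tsupport ρ
  · have hp : p ∉ tsupport φ := fun hp => h ⟨hz, hp⟩
    have h1 : φ p = 0 := image_eq_zero_of_notMem_tsupport hp
    have h2 : fderiv ℝ φ p = 0 := by
      by_contra hne
      exact hp (support_fderiv_subset ℝ hne)
    simp [katoA, katoB, katoD1, katoD2, h1, h2]
  · have h1 : ρ (ε⁻¹ • (p - q)) = 0 := image_eq_zero_of_notMem_tsupport hz
    have h2 : fderiv ℝ ρ (ε⁻¹ • (p - q)) = 0 := by
      by_contra hne
      exact hz (support_fderiv_subset ℝ hne)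
    simp [katoA, katoB, katoD1, katoD2, h1, h2]

lemma kato_doubled (T : ℝ)
    (f : Fin n → ℝ × Euc n × ℝ → ℝ) (g : ℝ × Euc n × ℝ → ℝ)
    (hf : ∀ i, ContDiff ℝ 1 (f i)) (hg : Continuous g)
    (u v : ℝ × Euc n → ℝ) (u₀ v₀ : Euc n → ℝ)
    (hu : IsEntropySol n T f g u u₀) (hv : IsEntropySol n T f g v v₀)
    (C : ℝ) (huC : ∀ p, |u p| ≤ C) (hvC : ∀ p, |v p| ≤ C)
    (φ ρ : ℝ × Euc n → ℝ)
    (hφ : ContDiff ℝ (⊤ : ℕ∞) φ) (hφc : HasCompactSupport φ) (hφ0 : ∀ p, 0 ≤ φ p)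
    (hρ : ContDiff ℝ (⊤ : ℕ∞) ρ) (hρ0 : ∀ p, 0 ≤ ρ p) (hρs : tsupport ρ ⊆ Metric.closedBall 0 1)
    (ε : ℝ) (hε : 0 < ε)
    (hsub : Metric.cthickening ε (tsupport φ) ⊆ Set.Ioo (0:ℝ) T ×ˢ (Set.univ : Set (Euc n))) :
    0 ≤ ∫ x : (ℝ × Euc n) × (ℝ × Euc n), Real.sign (u x.2 - v (x.2 - ε • x.1)) *
      katoH f g φ ρ (ε, x.1, x.2, u x.2, v (x.2 - ε • x.1))
        ∂((volume : Measure (ℝ × Euc n)).prod volume) := by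
  have hum := hu.1
  have hvm := hv.1
  have hum1 : Measurable (fun x : (ℝ × Euc n) × (ℝ × Euc n) => u x.1) := hum.comp measurable_fst
  have hvm2 : Measurable (fun x : (ℝ × Euc n) × (ℝ × Euc n) => v x.2) := hvm.comp measurable_snd
  obtain ⟨hAc, hBc⟩ := katoAB_cont f g φ ρ ε hf hg hφ hρ
  -- location of the support
  have hloc : ∀ p q, ε⁻¹ • (p - q) ∈ tsupport ρ → dist q p ≤ ε := by
    intro p q h
    have h1 := hρs h
    rw [mem_closedBall_zero_iff, norm_smul, norm_inv, Real.norm_eq_abs, abs_of_pos hε,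
      inv_mul_le_iff₀ hε, mul_one] at h1
    rwa [dist_comm, dist_eq_norm]
  have hlocK : ∀ p q, ε⁻¹ • (p - q) ∈ tsupport ρ → p ∈ tsupport φ →
      q ∈ Metric.cthickening ε (tsupport φ) := fun p q h1 h2 =>
    Metric.mem_cthickening_of_dist_le q p ε _ h2 (hloc p q h1)
  set S := Metric.cthickening ε (tsupport φ) with hS
  have hScomp : IsCompact S := hφc.isCompact.cthickening
  have hφS : tsupport φ ⊆ S := Metric.self_subset_cthickening _
  have hKc : IsCompact (tsupport φ ×ˢ S) := hφc.isCompact.prod hScomp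
  have hAB0 : ∀ x ∉ tsupport φ ×ˢ S, ∀ a b,
      katoA f g φ ρ ε (x, a, b) = 0 ∧ katoB f g φ ρ ε (x, a, b) = 0 := by
    rintro ⟨p, q⟩ hx a b
    exact katoAB_zero f g φ ρ ε p q a b fun h => hx ⟨h.2, hlocK p q h.1 h.2⟩
  set A : (ℝ × Euc n) × (ℝ × Euc n) → ℝ := fun x =>
    Real.sign (u x.1 - v x.2) * katoA f g φ ρ ε (x, u x.1, v x.2) with hA
  set B : (ℝ × Euc n) × (ℝ × Euc n) → ℝ := fun x =>
    Real.sign (u x.1 - v x.2) * katoB f g φ ρ ε (x, u x.1, v x.2) with hB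
  have hAi : Integrable A ((volume : Measure (ℝ × Euc n)).prod volume) :=
    kato_integrable _ (fun x => u x.1) (fun x => v x.2) hum1 hvm2 C (fun x => huC _) (fun x => hvC _) _ hAc _ hKc
      (fun x hx a b => (hAB0 x hx a b).1)
  have hBi : Integrable B ((volume : Measure (ℝ × Euc n)).prod volume) :=
    kato_integrable _ (fun x => u x.1) (fun x => v x.2) hum1 hvm2 C (fun x => huC _) (fun x => hvC _) _ hBc _ hKc
      (fun x hx a b => (hAB0 x hx a b).2)
  have hApos : 0 ≤ ∫ x, A x ∂((volume : Measure (ℝ × Euc n)).prod volume) := by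
    rw [integral_prod_symm _ hAi]
    refine integral_nonneg fun q => ?_
    have hsm : ContDiff ℝ (⊤ : ℕ∞) (fun p' => φ p' * ρ (ε⁻¹ • (p' - q))) :=
      hφ.mul (hρ.comp (by fun_prop))
    have := kato_entropy_full T f g u u₀ hu (v q) (fun p' => φ p' * ρ (ε⁻¹ • (p' - q))) hsm
      hφc.mul_right (fun p => mul_nonneg (hφ0 _) (hρ0 _)) (fun p hp => by
        have : p ∉ tsupport φ := fun h => hp (hsub (hφS h)).1
        rw [image_eq_zero_of_notMem_tsupport this, zero_mul])
    refine this.trans_eq (integral_congr_ae (ae_of_all _ fun p => ?_))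
    simp only [katoD1_eq φ ρ ε _ q _ hφ hρ]
    rfl
  have hBpos : 0 ≤ ∫ x, B x ∂((volume : Measure (ℝ × Euc n)).prod volume) := by
    rw [integral_prod _ hBi]
    refine integral_nonneg fun p => ?_
    have hsm : ContDiff ℝ (⊤ : ℕ∞) (fun q' => φ p * ρ (ε⁻¹ • (p - q'))) :=
      contDiff_const.mul (hρ.comp (by fun_prop))
    have hz : ∀ q ∉ S, φ p * ρ (ε⁻¹ • (p - q)) = 0 := by
      intro q hq
      by_cases hp : p ∈ tsupport φ
      · have : ε⁻¹ • (p - q) ∉ tsupport ρ := fun h => hq (hlocK p q h hp)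
        rw [image_eq_zero_of_notMem_tsupport this, mul_zero]
      · rw [image_eq_zero_of_notMem_tsupport hp, zero_mul]
    have := kato_entropy_full T f g v v₀ hv (u p) (fun q' => φ p * ρ (ε⁻¹ • (p - q'))) hsm
      (HasCompactSupport.intro hScomp hz) (fun p => mul_nonneg (hφ0 _) (hρ0 _))
      (fun q hq => hz q fun h => hq (hsub h).1)
    refine this.trans_eq (integral_congr_ae (ae_of_all _ fun q => ?_))
    simp only [katoD2_eq φ ρ ε p _ _ hρ]
    have hs : Real.sign (v q - u p) = -Real.sign (u p - v q) := by
      rw [← neg_sub, Real.sign_neg]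
    have hsum : ∑ i, (f i (q.1, q.2, v q) - f i (q.1, q.2, u p))
          * katoD2 φ ρ ε p q (0, EuclideanSpace.single i 1)
        = - ∑ i, (f i (q.1, q.2, u p) - f i (q.1, q.2, v q))
          * katoD2 φ ρ ε p q (0, EuclideanSpace.single i 1) := by
      rw [← Finset.sum_neg_distrib]
      refine Finset.sum_congr rfl fun i _ => by ring
    rw [hs, hsum, hB]
    simp only [katoB]
    ring
  have hsum : 0 ≤ ∫ x, (A x + B x) ∂((volume : Measure (ℝ × Euc n)).prod volume) := by
    rw [integral_add hAi hBi]; exact add_nonneg hApos hBpos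
  rw [integral_prod (fun x => A x + B x) (hAi.add hBi)] at hsum
  have hJi : Integrable (fun x : (ℝ × Euc n) × (ℝ × Euc n) =>
      Real.sign (u x.2 - v (x.2 - ε • x.1)) *
      katoH f g φ ρ (ε, x.1, x.2, u x.2, v (x.2 - ε • x.1)))
        ((volume : Measure (ℝ × Euc n)).prod volume) := by
    refine kato_integrable _ (fun x : (ℝ × Euc n) × (ℝ × Euc n) => u x.2)
      (fun x => v (x.2 - ε • x.1)) (hum.comp measurable_snd)
      (hvm.comp (by fun_prop)) C (fun x => huC _) (fun x => hvC _)
      (fun y => katoH f g φ ρ (ε, y.1.1, y.1.2, y.2.1, y.2.2))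
      ((katoH_cont f g φ ρ hf hg hφ hρ).comp (by fun_prop))
      (Metric.closedBall 0 1 ×ˢ tsupport φ) ((isCompact_closedBall _ _).prod hφc.isCompact) ?_
    intro x hx a b
    exact katoH_zero f g φ ρ ε _ _ _ _ fun h => hx ⟨hρs h.1, h.2⟩
  rw [integral_prod_symm _ hJi]
  have hkey : ∀ p : ℝ × Euc n, ∫ q, (A (p, q) + B (p, q)) =
      ε ^ Module.finrank ℝ (ℝ × Euc n) *
        ∫ z, Real.sign (u p - v (p - ε • z)) *
          katoH f g φ ρ (ε, z, p, u p, v (p - ε • z)) := by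
    intro p
    have h1 := Measure.integral_comp_smul (volume : Measure (ℝ × Euc n))
      (fun q => A (p, p - q) + B (p, p - q)) ε
    rw [integral_sub_left_eq_self (fun q => A (p, q) + B (p, q)) volume p, smul_eq_mul,
      abs_of_pos (by positivity)] at h1
    have h2 : ∀ z, A (p, p - ε • z) + B (p, p - ε • z) = Real.sign (u p - v (p - ε • z)) *
          katoH f g φ ρ (ε, z, p, u p, v (p - ε • z)) := by
      intro z
      simp only [hA, hB]
      rw [← katoAB_eq f g φ ρ ε hε hf]
      ring
    simp only [h2] at h1
    rw [h1, ← mul_assoc, mul_inv_cancel₀ (by positivity), one_mul]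
  simp only [hkey] at hsum
  rw [integral_const_mul] at hsum
  exact nonneg_of_mul_nonneg_right hsum (by positivity)

end KatoDoubling2

section KatoCore

open Topology

variable {n : ℕ}

lemma kato_parts (ρ : ℝ × Euc n → ℝ) (hρ : ContDiff ℝ (⊤ : ℕ∞) ρ) (hρc : HasCompactSupport ρ)
    (l : (ℝ × Euc n) →L[ℝ] ℝ) (w : ℝ × Euc n) :
    Integrable (fun z => fderiv ℝ ρ z w * l z) ∧
    ∫ z, fderiv ℝ ρ z w * l z = - (l w * ∫ z, ρ z) := by
  have h3 : Continuous (fderiv ℝ ρ) := hρ.continuous_fderiv (by simp)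
  have hdc : HasCompactSupport (fun z => fderiv ℝ ρ z w) := hρc.fderiv_apply ℝ w
  have i1 : Integrable (fun z => fderiv ℝ ρ z w * l z) :=
    Continuous.integrable_of_hasCompactSupport (by fun_prop) hdc.mul_right
  have hρcont := hρ.continuous
  have hlf : ∀ z, fderiv ℝ (fun z => l z) z = l := fun z => l.fderiv
  refine ⟨i1, ?_⟩
  have h := integral_mul_fderiv_eq_neg_fderiv_mul_of_integrable (μ := (volume : Measure (ℝ × Euc n)))
    (f := fun z => l z) (g := ρ) (v := w) ?_ ?_ ?_ ?_ ?_
  · simp only [hlf, integral_const_mul] at h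
    rw [← h]
    exact integral_congr_ae (ae_of_all _ fun z => mul_comm _ _)
  · simp only [hlf]
    exact (hρcont.integrable_of_hasCompactSupport hρc).const_mul _
  · simpa only [mul_comm] using i1
  · exact Continuous.integrable_of_hasCompactSupport (by fun_prop) hρc.mul_left
  · exact fun x _ => l.differentiableAt
  · exact fun x _ => hρ.differentiable (by simp) x

lemma katoH_integral (f : Fin n → ℝ × Euc n × ℝ → ℝ) (g : ℝ × Euc n × ℝ → ℝ)
    (φ ρ : ℝ × Euc n → ℝ) (hρ : ContDiff ℝ (⊤ : ℕ∞) ρ) (hρc : HasCompactSupport ρ)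
    (p : ℝ × Euc n) (a b : ℝ) :
    ∫ z, katoH f g φ ρ (0, z, p, a, b) = (∫ z, ρ z) *
      ((a - b) * fderiv ℝ φ p (1, 0)
        + ∑ i, (f i (p.1, p.2, a) - f i (p.1, p.2, b))
            * fderiv ℝ φ p (0, EuclideanSpace.single i 1)
        + (g (p.1, p.2, a) - g (p.1, p.2, b)) * φ p) := by
  let inc : (ℝ × Euc n) →L[ℝ] (ℝ × Euc n × ℝ) :=
    (ContinuousLinearMap.fst ℝ ℝ (Euc n)).prod ((ContinuousLinearMap.snd ℝ ℝ (Euc n)).prod 0)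
  let l : Fin n → (ℝ × Euc n) →L[ℝ] ℝ := fun i =>
    (fderiv ℝ (f i) (p.1, p.2, a) - fderiv ℝ (f i) (p.1, p.2, b)).comp inc
  have hl : ∀ i z, l i z = fderiv ℝ (f i) (p.1, p.2, a) (z.1, z.2, 0)
      - fderiv ℝ (f i) (p.1, p.2, b) (z.1, z.2, 0) := fun i z => rfl
  set X := (a - b) * fderiv ℝ φ p (1, 0)
        + ∑ i, (f i (p.1, p.2, a) - f i (p.1, p.2, b))
            * fderiv ℝ φ p (0, EuclideanSpace.single i 1)
        + (g (p.1, p.2, a) - g (p.1, p.2, b)) * φ p with hX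
  have h1 : ∀ z, katoH f g φ ρ (0, z, p, a, b) =
      ρ z * (X + (∑ i, l i (0, EuclideanSpace.single i 1)) * φ p) +
      (∑ i, fderiv ℝ ρ z (0, EuclideanSpace.single i 1) * l i z) * φ p := by
    intro z
    simp only [katoH, katoQ_zero, hl, zero_smul, sub_zero, hX]
  simp only [h1]
  have hP := fun i => kato_parts ρ hρ hρc (l i) (0, EuclideanSpace.single i 1)
  have hρi : Integrable ρ := hρ.continuous.integrable_of_hasCompactSupport hρc
  rw [integral_add (hρi.mul_const _)
    ((integrable_finsetSum _ fun i _ => (hP i).1).mul_const _), integral_mul_const,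
    integral_mul_const, integral_finsetSum _ fun i _ => (hP i).1]
  simp only [(hP _).2, Finset.sum_neg_distrib, ← Finset.sum_mul]
  ring

lemma kato_core (T : ℝ)
    (f : Fin n → ℝ × Euc n × ℝ → ℝ) (g : ℝ × Euc n × ℝ → ℝ)
    (hf : ∀ i, ContDiff ℝ 1 (f i)) (hg : Continuous g)
    (u v : ℝ × Euc n → ℝ) (u₀ v₀ : Euc n → ℝ)
    (hu : IsEntropySol n T f g u u₀) (hv : IsEntropySol n T f g v v₀)
    (C : ℝ) (huC : ∀ p, |u p| ≤ C) (hvC : ∀ p, |v p| ≤ C)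
    (φ : ℝ × Euc n → ℝ)
    (hφ : ContDiff ℝ (⊤ : ℕ∞) φ) (hφc : HasCompactSupport φ) (hφ0 : ∀ p, 0 ≤ φ p)
    (hsub : tsupport φ ⊆ Set.Ioo (0:ℝ) T ×ˢ (Set.univ : Set (Euc n))) :
    0 ≤ ∫ p, Real.sign (u p - v p) * ((u p - v p) * fderiv ℝ φ p (1, 0)
        + ∑ i, (f i (p.1, p.2, u p) - f i (p.1, p.2, v p))
            * fderiv ℝ φ p (0, EuclideanSpace.single i 1)
        + (g (p.1, p.2, u p) - g (p.1, p.2, v p)) * φ p) := by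
  obtain ⟨δ, hδ, hδsub⟩ := hφc.isCompact.exists_cthickening_subset_open
    (isOpen_Ioo.prod isOpen_univ) hsub
  obtain ⟨R, hR⟩ := hφc.isCompact.isBounded.subset_closedBall (0 : ℝ × Euc n)
  let bump : ContDiffBump (0 : ℝ × Euc n) := ⟨1/2, 1, by norm_num, by norm_num⟩
  let ρ : ℝ × Euc n → ℝ := bump
  have hρ : ContDiff ℝ (⊤ : ℕ∞) ρ := bump.contDiff
  have hρ0 : ∀ p, 0 ≤ ρ p := fun p => bump.nonneg
  have hρc : HasCompactSupport ρ := bump.hasCompactSupport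
  have hρs : tsupport ρ ⊆ Metric.closedBall 0 1 := bump.tsupport_eq.subset
  have hρint : 0 < ∫ z, ρ z := bump.integral_pos
  let e : ℕ → ℝ := fun k => min δ 1 * (1 / ((k:ℝ) + 1))
  have hm0 : 0 < min δ 1 := lt_min hδ one_pos
  have he0 : ∀ k, 0 < e k := fun k => mul_pos hm0 Nat.one_div_pos_of_nat
  have he1 : ∀ k, e k ≤ min δ 1 := fun k => by
    refine mul_le_of_le_one_right hm0.le ?_
    rw [div_le_one (by positivity)]
    have : (0:ℝ) ≤ k := Nat.cast_nonneg k
    linarith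
  have het : Tendsto e atTop (𝓝 0) := by
    have h := (tendsto_one_div_add_atTop_nhds_zero_nat (𝕜 := ℝ)).const_mul (min δ 1)
    rwa [mul_zero] at h
  have hHc := katoH_cont f g φ ρ hf hg hφ hρ
  have hlim := kato_limit (volume : Measure (ℝ × Euc n)) u v hu.1 hv.1 C huC hvC R
    (katoH f g φ ρ) hHc
    (fun ε z p a b h => katoH_zero f g φ ρ ε z p a b fun h' => h ⟨hρs h'.1, hR h'.2⟩)
    (fun z p a => by simp [katoH]) e het
    (fun k => by rw [abs_of_pos (he0 k)]; exact (he1 k).trans (min_le_right _ _))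
    (fun k => kato_doubled T f g hf hg u v u₀ v₀ hu hv C huC hvC φ ρ hφ hφc hφ0 hρ hρ0 hρs
      (e k) (he0 k) ((Metric.cthickening_mono ((he1 k).trans (min_le_left _ _)) _).trans hδsub))
  have hJi : Integrable (fun x : (ℝ × Euc n) × (ℝ × Euc n) =>
      Real.sign (u x.2 - v x.2) * katoH f g φ ρ (0, x.1, x.2, u x.2, v x.2))
        ((volume : Measure (ℝ × Euc n)).prod volume) := by
    refine kato_integrable _ (fun x : (ℝ × Euc n) × (ℝ × Euc n) => u x.2)
      (fun x => v x.2) (hu.1.comp measurable_snd)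
      (hv.1.comp measurable_snd) C (fun x => huC _) (fun x => hvC _)
      (fun y => katoH f g φ ρ (0, y.1.1, y.1.2, y.2.1, y.2.2))
      (hHc.comp (by fun_prop))
      (Metric.closedBall 0 1 ×ˢ tsupport φ) ((isCompact_closedBall _ _).prod hφc.isCompact) ?_
    intro x hx a b
    exact katoH_zero f g φ ρ 0 _ _ _ _ fun h => hx ⟨hρs h.1, h.2⟩
  rw [integral_prod_symm _ hJi] at hlim
  simp only [integral_const_mul, katoH_integral f g φ ρ hρ hρc] at hlim
  simp only [mul_left_comm _ (∫ z, ρ z) _, integral_const_mul] at hlim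
  exact nonneg_of_mul_nonneg_right hlim hρint

lemma kato_core_L (T M : ℝ)
    (f : Fin n → ℝ × Euc n × ℝ → ℝ) (g : ℝ × Euc n × ℝ → ℝ)
    (hf : ∀ i, ContDiff ℝ 1 (f i)) (hg : Continuous g)
    (u v : ℝ × Euc n → ℝ) (u₀ v₀ : Euc n → ℝ)
    (hu : IsEntropySol n T f g u u₀) (hv : IsEntropySol n T f g v v₀)
    (C : ℝ) (huC : ∀ p, |u p| ≤ C) (hvC : ∀ p, |v p| ≤ C)
    (hubd : ∀ᵐ p ∂(volume : Measure (ℝ × Euc n)), |u p| ≤ M)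
    (hvbd : ∀ᵐ p ∂(volume : Measure (ℝ × Euc n)), |v p| ≤ M)
    (φ : ℝ × Euc n → ℝ)
    (hφ : ContDiff ℝ (⊤ : ℕ∞) φ) (hφc : HasCompactSupport φ) (hφ0 : ∀ p, 0 ≤ φ p)
    (hsub : tsupport φ ⊆ Set.Ioo (0:ℝ) T ×ˢ (Set.univ : Set (Euc n)))
    (L : ℝ)
    (hL : ∀ p ∈ tsupport φ, ∀ w ∈ Set.Icc (-M) M, ∀ z ∈ Set.Icc (-M) M, w ≠ z →
      (g (p.1, p.2, w) - g (p.1, p.2, z)) / (w - z) ≤ L) :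
    0 ≤ ∫ p, Real.sign (u p - v p) * ((u p - v p) * fderiv ℝ φ p (1, 0)
        + ∑ i, (f i (p.1, p.2, u p) - f i (p.1, p.2, v p))
            * fderiv ℝ φ p (0, EuclideanSpace.single i 1)
        + L * (u p - v p) * φ p) := by
  refine (kato_core T f g hf hg u v u₀ v₀ hu hv C huC hvC φ hφ hφc hφ0 hsub).trans ?_
  have h2 : Continuous (fderiv ℝ φ) := hφ.continuous_fderiv (by simp)
  have h4 := fun i => (hf i).continuous
  have h5 := hφ.continuous
  have hd0 : ∀ p ∉ tsupport φ, fderiv ℝ φ p = 0 := by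
    intro p hp
    by_contra hne
    exact hp (support_fderiv_subset ℝ hne)
  refine integral_mono_ae ?_ ?_ ?_
  · refine kato_integrable _ u v hu.1 hv.1 C huC hvC
      (fun y => (y.2.1 - y.2.2) * fderiv ℝ φ y.1 (1, 0)
        + ∑ i, (f i (y.1.1, y.1.2, y.2.1) - f i (y.1.1, y.1.2, y.2.2))
            * fderiv ℝ φ y.1 (0, EuclideanSpace.single i 1)
        + (g (y.1.1, y.1.2, y.2.1) - g (y.1.1, y.1.2, y.2.2)) * φ y.1) (by fun_prop)
      (tsupport φ) hφc.isCompact (fun p hp a b => ?_)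
    simp [hd0 p hp, image_eq_zero_of_notMem_tsupport hp]
  · refine kato_integrable _ u v hu.1 hv.1 C huC hvC
      (fun y => (y.2.1 - y.2.2) * fderiv ℝ φ y.1 (1, 0)
        + ∑ i, (f i (y.1.1, y.1.2, y.2.1) - f i (y.1.1, y.1.2, y.2.2))
            * fderiv ℝ φ y.1 (0, EuclideanSpace.single i 1)
        + L * (y.2.1 - y.2.2) * φ y.1) (by fun_prop)
      (tsupport φ) hφc.isCompact (fun p hp a b => ?_)
    simp [hd0 p hp, image_eq_zero_of_notMem_tsupport hp]
  · filter_upwards [hubd, hvbd] with p hup hvp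
    by_cases hp : p ∈ tsupport φ
    · have hLp := hL p hp (u p) (abs_le.1 hup) (v p) (abs_le.1 hvp)
      have key : Real.sign (u p - v p) * (g (p.1, p.2, u p) - g (p.1, p.2, v p)) ≤
          Real.sign (u p - v p) * (L * (u p - v p)) := by
        rcases lt_trichotomy (u p - v p) 0 with h | h | h
        · have := hLp (by intro h'; linarith)
          rw [div_le_iff_of_neg h] at this
          rw [Real.sign_of_neg h]; linarith
        · simp [h]
        · have := hLp (by intro h'; linarith)
          rw [div_le_iff₀ h] at this
          rw [Real.sign_of_pos h]; linarith
      have := mul_le_mul_of_nonneg_right key (hφ0 p)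
      simp only [mul_add]
      linarith
    · simp [hd0 p hp, image_eq_zero_of_notMem_tsupport hp]

/-- cutoff profile -/
def katoM (r : ℝ) : ℝ := Real.smoothTransition (r - 1) * r

lemma katoM_smooth : ContDiff ℝ (⊤ : ℕ∞) katoM := by
  unfold katoM
  exact (Real.smoothTransition.contDiff.comp (by fun_prop)).mul contDiff_id

lemma katoM_deriv_one (r : ℝ) (hr : 2 < r) : deriv katoM r = 1 := by
  have : katoM =ᶠ[𝓝 r] id := by
    filter_upwards [lt_mem_nhds hr] with s hs
    rw [katoM, Real.smoothTransition.one_of_one_le (by linarith)]; simp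
  rw [this.deriv_eq]; simp

lemma katoM_deriv_bound : ∃ B : ℝ, ∀ r, 0 ≤ r → |deriv katoM r| ≤ B := by
  have hc : Continuous (deriv katoM) := katoM_smooth.continuous_deriv (by simp)
  obtain ⟨B, hB⟩ := (isCompact_Icc (a := (0:ℝ)) (b := 2)).exists_bound_of_continuousOn
    hc.continuousOn
  refine ⟨max B 1, fun r hr => ?_⟩
  by_cases h : r ≤ 2
  · exact (hB r ⟨hr, h⟩).trans (le_max_left _ _)
  · rw [katoM_deriv_one r (not_le.1 h)]; simp

end KatoCore
/-- the key doubling-of-variables inequality (5.18) of the paper.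
If `u, v` are Kruzkov entropy solutions bounded by `M` a.e., then for every nonnegative
test function `φ ∈ C_c^∞((0,T)×ℝⁿ)` and every constant `L` bounding the difference
quotients of `g` in `u` on `supp φ × [-M,M]` from above, one has
`∬ sgn(u-v) { (u-v) φ_t + ∑ (f_i(t,x,u) - f_i(t,x,v)) φ_{x_i} + L (u-v) φ } ≥ 0`. -/
theorem entropy_solutions_kato_inequality
    (n : ℕ) (hn : 1 ≤ n) (T M : ℝ) (hT : 0 < T)
    (f : Fin n → ℝ × Euc n × ℝ → ℝ) (g : ℝ × Euc n × ℝ → ℝ)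
    (hf : ∀ i, ContDiff ℝ 1 (f i))
    (hfxu : ∀ i j, Continuous fun p : ℝ × Euc n × ℝ =>
      fderiv ℝ (fun q => fderiv ℝ (f i) q (0, 0, 1)) p (0, EuclideanSpace.single j 1, 0))
    (hftu : ∀ i, Continuous fun p : ℝ × Euc n × ℝ =>
      fderiv ℝ (fun q => fderiv ℝ (f i) q (0, 0, 1)) p (1, 0, 0))
    (hg : Continuous g)
    (hgRL : ∀ Ω : Set (ℝ × Euc n), IsCompact Ω → ∀ a b : ℝ, a < b →
      ∃ L : ℝ, ∀ p ∈ Ω, ∀ w ∈ Set.Icc a b, ∀ z ∈ Set.Icc a b, w ≠ z →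
        (g (p.1, p.2, w) - g (p.1, p.2, z)) / (w - z) ≤ L)
    (u v : ℝ × Euc n → ℝ) (u₀ v₀ : Euc n → ℝ)
    (hu : IsEntropySol n T f g u u₀) (hv : IsEntropySol n T f g v v₀)
    (hubd : ∀ᵐ p ∂(volume : Measure (ℝ × Euc n)), |u p| ≤ M)
    (hvbd : ∀ᵐ p ∂(volume : Measure (ℝ × Euc n)), |v p| ≤ M)
    (φ : ℝ × Euc n → ℝ)
    (hφ : ContDiff ℝ (⊤ : ℕ∞) φ) (hφc : HasCompactSupport φ) (hφ0 : ∀ p, 0 ≤ φ p)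
    (hφsupp : ∀ p : ℝ × Euc n, p.1 ∉ Set.Ioo 0 T → φ p = 0)
    (L : ℝ)
    (hL : ∀ p ∈ tsupport φ, ∀ w ∈ Set.Icc (-M) M, ∀ z ∈ Set.Icc (-M) M, w ≠ z →
      (g (p.1, p.2, w) - g (p.1, p.2, z)) / (w - z) ≤ L) :
    0 ≤ ∫ p in (Set.Ioo (0:ℝ) T) ×ˢ (Set.univ : Set (Euc n)),
        Real.sign (u p - v p) *
          ((u p - v p) * fderiv ℝ φ p (1, 0)
            + ∑ i, (f i (p.1, p.2, u p) - f i (p.1, p.2, v p))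
                * fderiv ℝ φ p (0, EuclideanSpace.single i 1)
            + L * (u p - v p) * φ p) := by
  obtain ⟨C1, hC1⟩ := hu.2.1
  obtain ⟨C2, hC2⟩ := hv.2.1
  have huC : ∀ p, |u p| ≤ max C1 C2 := fun p => (hC1 p).trans (le_max_left _ _)
  have hvC : ∀ p, |v p| ≤ max C1 C2 := fun p => (hC2 p).trans (le_max_right _ _)
  have h2 : Continuous (fderiv ℝ φ) := hφ.continuous_fderiv (by simp)
  have h4 := fun i => (hf i).continuous
  have h5 := hφ.continuous
  have hd0 : ∀ p ∉ tsupport φ, fderiv ℝ φ p = 0 := by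
    intro p hp
    by_contra hne
    exact hp (support_fderiv_subset ℝ hne)
  rw [setIntegral_eq_integral_of_forall_compl_eq_zero]
  swap
  · intro p hp
    have hp1 : p.1 ∉ Set.Ioo 0 T := fun h => hp ⟨h, mem_univ _⟩
    rw [kato_fderiv_zero φ hφ0 p (hφsupp p hp1), hφsupp p hp1]
    simp
  set X1 : ℝ × Euc n → ℝ := fun p => Real.sign (u p - v p) *
    ((u p - v p) * fderiv ℝ φ p (1, 0)
      + ∑ i, (f i (p.1, p.2, u p) - f i (p.1, p.2, v p))
            * fderiv ℝ φ p (0, EuclideanSpace.single i 1)) with hX1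
  set X2 : ℝ × Euc n → ℝ := fun p => Real.sign (u p - v p) * (L * (u p - v p) * φ p) with hX2
  have hX1i : Integrable X1 := by
    refine kato_integrable _ u v hu.1 hv.1 _ huC hvC
      (fun y => (y.2.1 - y.2.2) * fderiv ℝ φ y.1 (1, 0)
        + ∑ i, (f i (y.1.1, y.1.2, y.2.1) - f i (y.1.1, y.1.2, y.2.2))
            * fderiv ℝ φ y.1 (0, EuclideanSpace.single i 1)) (by fun_prop)
      (tsupport φ) hφc.isCompact (fun p hp a b => ?_)
    simp [hd0 p hp]
  have hX2i : Integrable X2 := by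
    refine kato_integrable _ u v hu.1 hv.1 _ huC hvC
      (fun y => L * (y.2.1 - y.2.2) * φ y.1) (by fun_prop)
      (tsupport φ) hφc.isCompact (fun p hp a b => ?_)
    simp [image_eq_zero_of_notMem_tsupport hp]
  obtain ⟨B, hB⟩ := katoM_deriv_bound
  let c : ℕ → ℝ := fun k => (k : ℝ) + 1
  have hc : ∀ k, 0 < c k := fun k => by positivity
  have hMd : Continuous (deriv katoM) := katoM_smooth.continuous_deriv (by simp)
  have hσc : Continuous Real.smoothTransition := Real.smoothTransition.continuous
  let θ : ℕ → ℝ × Euc n → ℝ := fun k p => (c k)⁻¹ * katoM (c k * φ p)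
  have hθ1 : ∀ k p, θ k p = Real.smoothTransition (c k * φ p - 1) * φ p := by
    intro k p
    have := (hc k).ne'
    simp only [θ, katoM]
    field_simp
  have hθd : ∀ k p, fderiv ℝ (θ k) p = deriv katoM (c k * φ p) • fderiv ℝ φ p := by
    intro k p
    have ha : HasFDerivAt φ (fderiv ℝ φ p) p := (hφ.differentiable (by simp) p).hasFDerivAt
    have hb : HasDerivAt katoM (deriv katoM (c k * φ p)) (c k * φ p) :=
      (katoM_smooth.differentiable (by simp) _).hasDerivAt
    have hd := ((hb.comp_hasFDerivAt p (ha.const_mul (c k))).const_mul (c k)⁻¹).fderiv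
    simp only [Function.comp_def] at hd
    change fderiv ℝ (θ k) p = _ at hd
    rw [hd, smul_comm, inv_smul_smul₀ (hc k).ne']
  have hpos : ∀ k, 0 ≤ ∫ p, (deriv katoM (c k * φ p) * X1 p
      + Real.smoothTransition (c k * φ p - 1) * X2 p) := by
    intro k
    have hθs : ContDiff ℝ (⊤ : ℕ∞) (θ k) :=
      contDiff_const.mul (katoM_smooth.comp (contDiff_const.mul hφ))
    have hsupp : Function.support (θ k) ⊆ {p | (c k)⁻¹ ≤ φ p} := by
      intro p hp
      by_contra hlt
      apply hp
      have hlt' : φ p < (c k)⁻¹ := not_le.1 hlt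
      rw [hθ1, Real.smoothTransition.zero_of_nonpos, zero_mul]
      have : c k * φ p < c k * (c k)⁻¹ := mul_lt_mul_of_pos_left hlt' (hc k)
      rw [mul_inv_cancel₀ (hc k).ne'] at this
      linarith
    have hts : tsupport (θ k) ⊆ {p | (c k)⁻¹ ≤ φ p} :=
      closure_minimal hsupp (isClosed_le continuous_const h5)
    have hne : ∀ p ∈ tsupport (θ k), φ p ≠ 0 := fun p hp h => by
      have h1 : (c k)⁻¹ ≤ φ p := hts hp
      have h3 : 0 < (c k)⁻¹ := inv_pos.2 (hc k)
      linarith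
    have hts2 : tsupport (θ k) ⊆ tsupport φ := fun p hp =>
      subset_tsupport φ (hne p hp)
    have hθc : HasCompactSupport (θ k) := hφc.isCompact.of_isClosed_subset (isClosed_tsupport _) hts2
    have h := kato_core_L T M f g hf hg u v u₀ v₀ hu hv _ huC hvC hubd hvbd (θ k) hθs hθc
      (fun p => by
        rw [hθ1]; exact mul_nonneg (Real.smoothTransition.nonneg _) (hφ0 p))
      (fun p hp => ⟨by
        by_contra hn
        exact hne p hp (hφsupp p hn), mem_univ _⟩) L (fun p hp => hL p (hts2 hp))
    refine h.trans_eq (integral_congr_ae (ae_of_all _ fun p => ?_))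
    simp only [hθd, hθ1, hX1, hX2, smul_apply, smul_eq_mul,
      mul_left_comm _ (deriv katoM (c k * φ p)) _, ← Finset.mul_sum]
    ring
  have hlim : Tendsto (fun k => ∫ p, (deriv katoM (c k * φ p) * X1 p
      + Real.smoothTransition (c k * φ p - 1) * X2 p)) atTop (nhds (∫ p, (X1 p + X2 p))) := by
    refine tendsto_integral_of_dominated_convergence (fun p => B * |X1 p| + |X2 p|) ?_ ?_ ?_ ?_
    · intro k
      refine AEStronglyMeasurable.add (AEStronglyMeasurable.mul ?_ hX1i.1)
        (AEStronglyMeasurable.mul ?_ hX2i.1)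
      · exact (show Continuous fun p => deriv katoM (c k * φ p) by fun_prop).aestronglyMeasurable
      · exact (show Continuous fun p => Real.smoothTransition (c k * φ p - 1) by
          fun_prop).aestronglyMeasurable
    · exact (hX1i.abs.const_mul B).add hX2i.abs
    · intro k
      refine ae_of_all _ fun p => ?_
      rw [Real.norm_eq_abs]
      refine (abs_add_le _ _).trans (add_le_add ?_ ?_)
      · rw [abs_mul]
        exact mul_le_mul_of_nonneg_right (hB _ (mul_nonneg (hc k).le (hφ0 p))) (abs_nonneg _)
      · rw [abs_mul, abs_of_nonneg (Real.smoothTransition.nonneg _)]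
        exact mul_le_of_le_one_left (abs_nonneg _) (Real.smoothTransition.le_one _)
    · refine ae_of_all _ fun p => ?_
      rcases (hφ0 p).eq_or_lt with h0 | h0
      · have e1 : X1 p = 0 := by
          simp [hX1, kato_fderiv_zero φ hφ0 p h0.symm]
        have e2 : X2 p = 0 := by simp [hX2, ← h0]
        simp [e1, e2]
      · refine tendsto_const_nhds.congr' ?_
        have hct : Tendsto (fun k => c k * φ p) atTop atTop :=
          (tendsto_atTop_add_const_right _ _ tendsto_natCast_atTop_atTop).atTop_mul_const h0
        filter_upwards [hct.eventually_gt_atTop 2] with k hk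
        rw [katoM_deriv_one _ hk, Real.smoothTransition.one_of_one_le (by linarith)]
        ring
  have hfin : 0 ≤ ∫ p, (X1 p + X2 p) := ge_of_tendsto' hlim hpos
  refine hfin.trans_eq (integral_congr_ae (ae_of_all _ fun p => ?_))
  simp only [hX1, hX2]
  ring
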